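/- Let k ≥ 1 and n₁, …, n_k ≥ 2 be integers, and let G = SL(n₁, ℝ) × ⋯ × SL(n_k, ℝ) with its standard topology. Then for every compact symmetric generating subset Q of G with 1 ∈ Q, every continuous 1-cocycle over every unitary representation of G on a complex Hilbert space has sublinear growth with respect to the word length |·|_Q. -/

import Mathlib

open MeasureTheory Filter Topology
open scoped Pointwise

/-- The standard (matrix) topology on `SL(n, ℝ)`, induced from the space of matrices. -/
noncomputable instance specialLinearGroupTopology {m : Type*} [DecidableEq m] [Fintype m] :
    TopologicalSpace (Matrix.SpecialLinearGroup m ℝ) :=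
  TopologicalSpace.induced ((↑) : Matrix.SpecialLinearGroup m ℝ → Matrix m m ℝ) inferInstance

/-- The word length of `g` with respect to a generating set `Q` (symmetric, containing `1`):
the least `n` such that `g` is a product of `n` elements of `Q`. -/
noncomputable def wordLength {G : Type*} [Group G] (Q : Set G) (g : G) : ℕ :=
  sInf {n : ℕ | g ∈ Q ^ n}

/-- A map `b : G → H` into a normed space has sublinear growth with respect to the word
length `|·|_Q` if for every `ε > 0` there is `N` with `‖b g‖ < ε * |g|_Q` whenever `|g|_Q > N`. -/
def HasSublinearGrowth {G : Type*} [Group G] {H : Type*} [NormedAddCommGroup H]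
    (Q : Set G) (b : G → H) : Prop :=
  ∀ ε : ℝ, 0 < ε → ∃ N : ℕ, ∀ g : G, N < wordLength Q g →
    ‖b g‖ < ε * (wordLength Q g : ℝ)

section Cocycle

variable {G : Type*} [Group G] {H : Type*} [NormedAddCommGroup H] [InnerProductSpace ℂ H]
  {π : G →* (H ≃ₗᵢ[ℂ] H)} {b : G → H}

lemma unitaryRep_mul_apply (g h : G) (v : H) : π (g * h) v = π g (π h v) := by
  rw [map_mul]; rfl

lemma cocycle_one (hb : ∀ g h, b (g * h) = b g + π g (b h)) : b 1 = 0 := by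
  simpa using hb 1 1

lemma norm_cocycle_mul_le (hb : ∀ g h, b (g * h) = b g + π g (b h)) (g h : G) :
    ‖b (g * h)‖ ≤ ‖b g‖ + ‖b h‖ := by
  rw [hb]
  exact (norm_add_le _ _).trans_eq (by rw [(π g).norm_map])

lemma cocycle_inv (hb : ∀ g h, b (g * h) = b g + π g (b h)) (g : G) :
    b g⁻¹ = -π g⁻¹ (b g) := by
  have h := hb g⁻¹ g
  rw [inv_mul_cancel, cocycle_one hb] at h
  exact eq_neg_of_add_eq_zero_left h.symm

lemma norm_cocycle_inv (hb : ∀ g h, b (g * h) = b g + π g (b h)) (g : G) :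
    ‖b g⁻¹‖ = ‖b g‖ := by
  rw [cocycle_inv hb, norm_neg, (π g⁻¹).norm_map]

lemma cocycle_pow_eq_birkhoffSum (hb : ∀ g h, b (g * h) = b g + π g (b h)) (a : G) (n : ℕ) :
    b (a ^ n) = birkhoffSum (π a) _root_.id n (b a) := by
  induction n with
  | zero => simpa using cocycle_one hb
  | succ n ih =>
    rw [pow_succ', hb, ih, birkhoffSum_succ', birkhoffSum, birkhoffSum, map_sum]
    simp [← Function.iterate_succ_apply', Function.iterate_succ_apply]

variable [TopologicalSpace G]

/-- The Mautner phenomenon. -/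
lemma map_eq_self_of_tendsto_conj (hπ : ∀ v : H, Continuous fun g => π g v) {a x : G} {v : H}
    (hv : π a v = v) (hx : Tendsto (fun n : ℕ => a ^ n * x * (a ^ n)⁻¹) atTop (𝓝 1)) :
    π x v = v := by
  have hpow (n : ℕ) : π (a ^ n) v = v := by
    induction n with
    | zero => simp
    | succ n ih => rw [pow_succ, unitaryRep_mul_apply, hv, ih]
  have hpow' (n : ℕ) : π (a ^ n)⁻¹ v = v := by
    conv_lhs => rw [← hpow n]
    rw [← unitaryRep_mul_apply]
    simp
  have hlim := ((hπ v).tendsto 1).comp hx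
  have hdist : Tendsto (fun n : ℕ => dist (π (a ^ n * x * (a ^ n)⁻¹) v) v) atTop (𝓝 0) := by
    simpa using hlim.dist (tendsto_const_nhds (x := v))
  have hconst (n : ℕ) : dist (π (a ^ n * x * (a ^ n)⁻¹) v) v = dist (π x v) v := by
    rw [unitaryRep_mul_apply, unitaryRep_mul_apply, hpow']
    conv_lhs => rw [← hpow n]
    rw [hpow n, ← (π (a ^ n)).dist_map (π x v) v, hpow n]
  simp only [hconst] at hdist
  exact dist_eq_zero.1 (tendsto_nhds_unique tendsto_const_nhds hdist)

/-- The stabilizer of `v` on which the cocycle is moreover orthogonal to `v`. -/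
def cocycleOrthogonalSubgroup (hb : ∀ g h, b (g * h) = b g + π g (b h)) (v : H) :
    Subgroup G where
  carrier := {g | π g v = v ∧ inner ℂ v (b g) = 0}
  one_mem' := by simp [cocycle_one hb]
  mul_mem' := by
    rintro g h ⟨hg, hg'⟩ ⟨hh, hh'⟩
    refine ⟨by rw [unitaryRep_mul_apply, hh, hg], ?_⟩
    rw [hb, inner_add_right, hg', zero_add]
    conv_lhs => rw [← hg]
    rw [(π g).inner_map_map, hh']
  inv_mem' := by
    rintro g ⟨hg, hg'⟩
    have h : π g⁻¹ v = v := by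
      conv_lhs => rw [← hg]
      rw [← unitaryRep_mul_apply]
      simp
    refine ⟨h, ?_⟩
    rw [cocycle_inv hb, inner_neg_right]
    conv_lhs => rw [← h]
    rw [(π g⁻¹).inner_map_map, hg', neg_zero]

lemma mem_cocycleOrthogonalSubgroup_of_tendsto_conj (hπ : ∀ v : H, Continuous fun g => π g v)
    (hbcont : Continuous b) (hb : ∀ g h, b (g * h) = b g + π g (b h)) {a x : G} {v : H}
    (hv : π a v = v) (hx : Tendsto (fun n : ℕ => a ^ n * x * (a ^ n)⁻¹) atTop (𝓝 1)) :
    x ∈ cocycleOrthogonalSubgroup hb v := by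
  have hxv := map_eq_self_of_tendsto_conj hπ hv hx
  refine ⟨hxv, ?_⟩
  have hadd {g h : G} (hg : π g v = v) :
      inner ℂ v (b (g * h)) = inner ℂ v (b g) + inner ℂ v (b h) := by
    rw [hb, inner_add_right]
    congr 1
    conv_lhs => rw [← hg]
    rw [(π g).inner_map_map]
  have hpow (n : ℕ) : π (a ^ n) v = v := by
    induction n with
    | zero => simp
    | succ n ih => rw [pow_succ, unitaryRep_mul_apply, hv, ih]
  have hconst (n : ℕ) : inner ℂ v (b (a ^ n * x * (a ^ n)⁻¹)) = inner ℂ v (b x) := by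
    have h1 : inner ℂ v (b (a ^ n)) + inner ℂ v (b (a ^ n)⁻¹) = 0 := by
      rw [← hadd (hpow n), mul_inv_cancel, cocycle_one hb, inner_zero_right]
    rw [mul_assoc, hadd (hpow n), hadd hxv]
    linear_combination h1
  have hlim : Tendsto (fun n : ℕ => inner ℂ v (b (a ^ n * x * (a ^ n)⁻¹))) atTop (𝓝 0) := by
    have h := ((continuous_const.inner hbcont : Continuous fun g =>
      inner ℂ v (b g)).tendsto 1).comp hx
    simpa [cocycle_one hb, Function.comp_def] using h
  simp only [hconst] at hlim
  exact tendsto_nhds_unique tendsto_const_nhds hlim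

/-- If `a` is generated by the elements it contracts or expands, a cocycle is sublinear along
the powers of `a`. -/
lemma tendsto_inv_smul_cocycle_pow [CompleteSpace H] (hπ : ∀ v : H, Continuous fun g => π g v)
    (hbcont : Continuous b) (hb : ∀ g h, b (g * h) = b g + π g (b h)) {a : G}
    (ha : a ∈ Subgroup.closure
      {x | Tendsto (fun n : ℕ => a ^ n * x * (a ^ n)⁻¹) atTop (𝓝 1) ∨
        Tendsto (fun n : ℕ => a⁻¹ ^ n * x * (a⁻¹ ^ n)⁻¹) atTop (𝓝 1)}) :
    Tendsto (fun n : ℕ => (n : ℂ)⁻¹ • b (a ^ n)) atTop (𝓝 0) := by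
  have horth (v : H) (hv : π a v = v) : inner ℂ v (b a) = 0 := by
    have hv' : π a⁻¹ v = v := by
      conv_lhs => rw [← hv]
      rw [← unitaryRep_mul_apply]
      simp
    refine ((Subgroup.closure_le (cocycleOrthogonalSubgroup hb v)).2 ?_ ha).2
    rintro x (hx | hx)
    · exact mem_cocycleOrthogonalSubgroup_of_tendsto_conj hπ hbcont hb hv hx
    · exact mem_cocycleOrthogonalSubgroup_of_tendsto_conj hπ hbcont hb hv' hx
  set U : H →L[ℂ] H := (π a).toLinearIsometry.toContinuousLinearMap
  have hU := U.tendsto_birkhoffAverage_orthogonalProjection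
    (LinearIsometry.norm_toContinuousLinearMap_le _) (b a)
  have hzero : (U.eqLocus (1 : H →L[ℂ] H)).orthogonalProjectionOnto (b a) = 0 := by
    rw [Submodule.orthogonalProjectionOnto_eq_zero_iff, Submodule.mem_orthogonal]
    exact fun v hv => horth v hv
  rw [hzero] at hU
  refine hU.congr fun n => ?_
  rw [birkhoffAverage, cocycle_pow_eq_birkhoffSum hb]
  rfl

end Cocycle

/-- A symmetric subadditive continuous function on `ℝ` that is sublinear along `ℕ` is
sublinear. -/
lemma exists_le_mul_abs_add_of_subadditive {f : ℝ → ℝ} (hf : Continuous f)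
    (hadd : ∀ x y, f (x + y) ≤ f x + f y) (hneg : ∀ x, f (-x) = f x)
    (hlim : Tendsto (fun n : ℕ => (n : ℝ)⁻¹ * f n) atTop (𝓝 0)) {ε : ℝ} (hε : 0 < ε) :
    ∃ C, ∀ x, f x ≤ ε * |x| + C := by
  obtain ⟨C₁, hC₁⟩ := isCompact_Icc.bddAbove_image (hf.continuousOn (s := Set.Icc 0 1))
  obtain ⟨N, hN⟩ := eventually_atTop.1 (hlim.eventually (gt_mem_nhds hε))
  obtain ⟨C₂, hC₂⟩ := isCompact_Icc.bddAbove_image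
    (hf.continuousOn (s := Set.Icc 0 ((N : ℝ) + 1)))
  have key (x : ℝ) (hx : 0 ≤ x) : f x ≤ ε * x + (|C₁| + |C₂|) := by
    rcases le_total x (N + 1) with h | h
    · have := hC₂ (Set.mem_image_of_mem f ⟨hx, h⟩)
      have := le_abs_self C₂
      have := abs_nonneg C₁
      have := mul_nonneg hε.le hx
      linarith
    · have hfl := Nat.floor_le hx
      have hlt := Nat.lt_floor_add_one x
      have hge : N + 1 ≤ ⌊x⌋₊ := Nat.le_floor (by exact_mod_cast h)
      have h1 := hadd (⌊x⌋₊ : ℝ) (x - ⌊x⌋₊)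
      rw [add_sub_cancel] at h1
      have h2 := hC₁ (Set.mem_image_of_mem f
        (⟨by linarith, by linarith⟩ : x - ⌊x⌋₊ ∈ Set.Icc (0 : ℝ) 1))
      have hpos : (0 : ℝ) < ⌊x⌋₊ := by exact_mod_cast (by omega : 0 < ⌊x⌋₊)
      have h3 : f ⌊x⌋₊ < ⌊x⌋₊ * ε := (inv_mul_lt_iff₀ hpos).1 (hN _ (by omega))
      have := le_abs_self C₁
      have := abs_nonneg C₂
      nlinarith
  refine ⟨|C₁| + |C₂|, fun x => ?_⟩
  rcases le_total 0 x with h | h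
  · simpa [abs_of_nonneg h] using key x h
  · simpa [abs_of_nonpos h, hneg] using key (-x) (by linarith)

section SpecialLinear

open Matrix
open scoped Matrix.Norms.L2Operator

variable {ι : Type*} [Fintype ι] [DecidableEq ι]

lemma specialLinearGroup_eq_of_coe_eq {g h : SpecialLinearGroup ι ℝ}
    (hgh : (g : Matrix ι ι ℝ) = h) : g = h :=
  Subtype.ext hgh

/-- The diagonal matrix with entries `exp (s j)`, the entry at `i₀` being rescaled so that the
determinant is `1`. -/
noncomputable def diagExp (i₀ : ι) (s : ι → ℝ) : SpecialLinearGroup ι ℝ :=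
  ⟨diagonal fun j => Real.exp (s j - if j = i₀ then ∑ k, s k else 0), by
    rw [det_diagonal, ← Real.exp_sum, Finset.sum_sub_distrib]
    simp⟩

lemma coe_diagExp (i₀ : ι) (s : ι → ℝ) : (diagExp i₀ s : Matrix ι ι ℝ) =
    diagonal fun j => Real.exp (s j - if j = i₀ then ∑ k, s k else 0) := rfl

lemma coe_diagExp_of_sum_eq_zero (i₀ : ι) {s : ι → ℝ} (hs : ∑ k, s k = 0) :
    (diagExp i₀ s : Matrix ι ι ℝ) = diagonal fun j => Real.exp (s j) := by
  simp [coe_diagExp, hs]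

lemma diagExp_add (i₀ : ι) (s t : ι → ℝ) :
    diagExp i₀ (s + t) = diagExp i₀ s * diagExp i₀ t := by
  apply specialLinearGroup_eq_of_coe_eq
  rw [Matrix.SpecialLinearGroup.coe_mul, coe_diagExp, coe_diagExp, coe_diagExp,
    diagonal_mul_diagonal]
  congr 1
  funext j
  rw [← Real.exp_add]
  congr 1
  split_ifs
  · simp only [Pi.add_apply, Finset.sum_add_distrib]
    ring
  · simp

lemma diagExp_zero (i₀ : ι) : diagExp i₀ (0 : ι → ℝ) = 1 := by
  apply specialLinearGroup_eq_of_coe_eq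
  simp [coe_diagExp]

lemma diagExp_neg (i₀ : ι) (s : ι → ℝ) : diagExp i₀ (-s) = (diagExp i₀ s)⁻¹ := by
  rw [eq_inv_iff_mul_eq_one, ← diagExp_add, neg_add_cancel, diagExp_zero]

lemma diagExp_nsmul (i₀ : ι) (s : ι → ℝ) (n : ℕ) : diagExp i₀ (n • s) = diagExp i₀ s ^ n := by
  induction n with
  | zero => simp [diagExp_zero]
  | succ n ih => rw [succ_nsmul, diagExp_add, ih, pow_succ]

lemma diagExp_single_self (i₀ : ι) (x : ℝ) : diagExp i₀ (Pi.single i₀ x) = 1 := by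
  apply specialLinearGroup_eq_of_coe_eq
  rw [coe_diagExp, Matrix.SpecialLinearGroup.coe_one, ← diagonal_one]
  congr 1
  funext j
  by_cases h : j = i₀
  · subst h; simp
  · simp [h]

lemma continuous_diagExp (i₀ : ι) : Continuous (diagExp i₀ : (ι → ℝ) → _) := by
  rw [continuous_induced_rng]
  refine Continuous.matrix_diagonal (continuous_pi fun j => Real.continuous_exp.comp ?_)
  split_ifs <;> fun_prop

lemma diagExp_conj_transvection (i₀ : ι) (s : ι → ℝ) {i j : ι} (hij : i ≠ j) (x : ℝ) :
    diagExp i₀ s * Matrix.SpecialLinearGroup.transvection hij x * (diagExp i₀ s)⁻¹ =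
      Matrix.SpecialLinearGroup.transvection hij
        (Real.exp ((s i - if i = i₀ then ∑ k, s k else 0) -
          (s j - if j = i₀ then ∑ k, s k else 0)) * x) := by
  rw [mul_inv_eq_iff_eq_mul]
  apply specialLinearGroup_eq_of_coe_eq
  rw [Matrix.SpecialLinearGroup.coe_mul, Matrix.SpecialLinearGroup.coe_mul, coe_diagExp,
    Matrix.SpecialLinearGroup.transvection_coe, Matrix.SpecialLinearGroup.transvection_coe,
    Real.exp_sub, mul_add, add_mul, mul_one, one_mul]
  congr 1
  ext p q
  rw [diagonal_mul, mul_diagonal, single_apply, single_apply]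
  by_cases h : i = p ∧ j = q
  · obtain ⟨rfl, rfl⟩ := h
    simp only [and_self, if_true]
    rw [mul_right_comm, div_mul_cancel₀ _ (Real.exp_ne_zero _)]
  · rw [if_neg h, if_neg h, mul_zero, zero_mul]

lemma diagExp_single_eq_transvection (i₀ : ι) {j : ι} (hj : i₀ ≠ j) (x : ℝ) :
    diagExp i₀ (Pi.single j x) =
      Matrix.SpecialLinearGroup.transvection hj (Real.exp (-x)) *
      Matrix.SpecialLinearGroup.transvection hj.symm (-Real.exp x) *
      Matrix.SpecialLinearGroup.transvection hj (Real.exp (-x)) *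
      Matrix.SpecialLinearGroup.transvection hj (-1) *
      Matrix.SpecialLinearGroup.transvection hj.symm 1 *
      Matrix.SpecialLinearGroup.transvection hj (-1) := by
  have hx : Real.exp (-x) * Real.exp x = 1 := by rw [← Real.exp_add]; simp
  have hD : (diagExp i₀ (Pi.single j x) : Matrix ι ι ℝ) =
      1 + single i₀ i₀ (Real.exp (-x) - 1) + single j j (Real.exp x - 1) := by
    ext p q
    rw [coe_diagExp]
    simp only [diagonal_apply, Matrix.add_apply, one_apply, single_apply, Pi.single_apply]
    by_cases hpq : p = q
    · subst hpq
      by_cases h1 : p = i₀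
      · subst h1; simp [hj, hj.symm]
      · by_cases h2 : p = j
        · subst h2; simp [hj, hj.symm]
        · simp [h1, h2, Ne.symm h1, Ne.symm h2]
    · have h1 : ¬ (i₀ = p ∧ i₀ = q) := fun h => hpq (h.1.symm.trans h.2)
      have h2 : ¬ (j = p ∧ j = q) := fun h => hpq (h.1.symm.trans h.2)
      simp [hpq, h1, h2]
  apply specialLinearGroup_eq_of_coe_eq
  rw [hD]
  simp only [Matrix.SpecialLinearGroup.coe_mul, Matrix.SpecialLinearGroup.transvection_coe]
  simp only [mul_add, add_mul, mul_one, one_mul, single_mul_single_same,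
    single_mul_single_of_ne _ _ _ _ hj, single_mul_single_of_ne _ _ _ _ hj.symm, add_zero]
  generalize Real.exp (-x) = E at *
  generalize Real.exp x = F at *
  ext p q
  simp only [Matrix.add_apply, single_apply, one_apply]
  grind

lemma continuous_transvection {i j : ι} (hij : i ≠ j) :
    Continuous fun x : ℝ => Matrix.SpecialLinearGroup.transvection hij x := by
  rw [continuous_induced_rng]
  refine continuous_matrix fun p q => ?_
  simp only [Function.comp_apply, Matrix.SpecialLinearGroup.transvection_coe, Matrix.add_apply,
    single_apply]
  split_ifs <;> fun_prop

lemma tendsto_diagExp_conj_transvection (i₀ : ι) {s : ι → ℝ} {i j : ι} (hij : i ≠ j) (x : ℝ)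
    (hs : (s i - if i = i₀ then ∑ k, s k else 0) - (s j - if j = i₀ then ∑ k, s k else 0) < 0) :
    Tendsto (fun n : ℕ => diagExp i₀ s ^ n * Matrix.SpecialLinearGroup.transvection hij x *
      (diagExp i₀ s ^ n)⁻¹) atTop (𝓝 1) := by
  set c := (s i - if i = i₀ then ∑ k, s k else 0) - (s j - if j = i₀ then ∑ k, s k else 0)
  have key (n : ℕ) : diagExp i₀ s ^ n * Matrix.SpecialLinearGroup.transvection hij x *
      (diagExp i₀ s ^ n)⁻¹ = Matrix.SpecialLinearGroup.transvection hij (Real.exp c ^ n * x) := by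
    induction n with
    | zero => simp
    | succ n ih =>
      rw [pow_succ', _root_.mul_inv_rev, show ∀ a p t : SpecialLinearGroup ι ℝ,
        a * p * t * (p⁻¹ * a⁻¹) = a * (p * t * p⁻¹) * a⁻¹ by intros; group, ih,
        diagExp_conj_transvection, pow_succ', mul_assoc]
  simp only [key]
  have h := (tendsto_pow_atTop_nhds_zero_of_lt_one (Real.exp_pos c).le
    (Real.exp_lt_one_iff.2 hs)).mul_const x
  rw [zero_mul] at h
  have h2 := ((continuous_transvection hij).tendsto 0).comp h
  rwa [Matrix.SpecialLinearGroup.transvection_coeff_zero] at h2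

lemma diagExp_single_mem_closure (i₀ : ι) {j : ι} (hj : i₀ ≠ j) {a : SpecialLinearGroup ι ℝ}
    (ha : a = diagExp i₀ (Pi.single j 1)) :
    a ∈ Subgroup.closure
      {x | Tendsto (fun n : ℕ => a ^ n * x * (a ^ n)⁻¹) atTop (𝓝 1) ∨
        Tendsto (fun n : ℕ => a⁻¹ ^ n * x * (a⁻¹ ^ n)⁻¹) atTop (𝓝 1)} := by
  set S := Subgroup.closure
      {x | Tendsto (fun n : ℕ => a ^ n * x * (a ^ n)⁻¹) atTop (𝓝 1) ∨
        Tendsto (fun n : ℕ => a⁻¹ ^ n * x * (a⁻¹ ^ n)⁻¹) atTop (𝓝 1)}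
  have h1 (x : ℝ) : Matrix.SpecialLinearGroup.transvection hj x ∈ S := by
    refine Subgroup.subset_closure (Or.inl ?_)
    rw [ha]
    exact tendsto_diagExp_conj_transvection i₀ hj x (by simp [hj, hj.symm])
  have h2 (x : ℝ) : Matrix.SpecialLinearGroup.transvection hj.symm x ∈ S := by
    refine Subgroup.subset_closure (Or.inr ?_)
    rw [ha, ← diagExp_neg]
    exact tendsto_diagExp_conj_transvection i₀ hj.symm x (by simp [hj, hj.symm])
  have h3 := diagExp_single_eq_transvection i₀ hj 1
  rw [← ha] at h3
  rw [h3]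
  exact S.mul_mem (S.mul_mem (S.mul_mem (S.mul_mem (S.mul_mem (h1 _) (h2 _)) (h1 _)) (h1 _))
    (h2 _)) (h1 _)

lemma isCompact_setOf_mem_unitaryGroup :
    IsCompact {g : SpecialLinearGroup ι ℝ | (g : Matrix ι ι ℝ) ∈ unitaryGroup ι ℝ} := by
  have hind : IsInducing fun g : Matrix.SpecialLinearGroup ι ℝ => (g : Matrix ι ι ℝ) := ⟨rfl⟩
  rw [hind.isCompact_iff]
  have hbox : IsCompact {A : Matrix ι ι ℝ | ∀ i j, A i j ∈ Set.Icc (-1 : ℝ) 1} :=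
    isCompact_Icc.matrix
  refine hbox.of_isClosed_subset ?_ ?_
  · have : (fun g : Matrix.SpecialLinearGroup ι ℝ => (g : Matrix ι ι ℝ)) ''
        {g | (g : Matrix ι ι ℝ) ∈ unitaryGroup ι ℝ} =
        {A : Matrix ι ι ℝ | A * star A = 1} ∩ {A | A.det = 1} := by
      ext A
      constructor
      · rintro ⟨g, hg, rfl⟩
        exact ⟨mem_unitaryGroup_iff.1 hg, g.2⟩
      · rintro ⟨h1, h2⟩
        exact ⟨⟨A, h2⟩, mem_unitaryGroup_iff.2 h1, rfl⟩
    rw [this]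
    refine (isClosed_eq ?_ continuous_const).inter (isClosed_eq ?_ continuous_const)
    · exact continuous_id.matrix_mul continuous_id.matrix_conjTranspose
    · exact continuous_id.matrix_det
  · rintro _ ⟨g, hg, rfl⟩ i j
    exact abs_le.1 (entry_norm_bound_of_unitary hg i j)

/-- The Cartan decomposition of `SL(n, ℝ)`. -/
lemma exists_eq_unitary_mul_diagExp_mul_unitary (i₀ : ι) (g : SpecialLinearGroup ι ℝ) :
    ∃ u v : SpecialLinearGroup ι ℝ, ∃ s : ι → ℝ, (u : Matrix ι ι ℝ) ∈ unitaryGroup ι ℝ ∧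
      (v : Matrix ι ι ℝ) ∈ unitaryGroup ι ℝ ∧ ∑ k, s k = 0 ∧ g = u * diagExp i₀ s * v := by
  set A : Matrix ι ι ℝ := (g : Matrix ι ι ℝ)ᴴ * g with hAdef
  have hgu : IsUnit (g : Matrix ι ι ℝ) := (isUnit_iff_isUnit_det _).2 (by simp)
  have hpos : A.PosDef := by
    refine PosDef.conjTranspose_mul_self _ ?_
    exact mulVec_injective_of_isUnit hgu
  have hA := hpos.isHermitian
  set V : Matrix ι ι ℝ := hA.eigenvectorUnitary.1 with hV
  have hVV : Vᴴ * V = 1 := mem_unitaryGroup_iff'.1 hA.eigenvectorUnitary.2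
  have hVV' : V * Vᴴ = 1 := mem_unitaryGroup_iff.1 hA.eigenvectorUnitary.2
  set l := hA.eigenvalues with hl
  have hlpos (j : ι) : 0 < l j := hpos.eigenvalues_pos j
  have hspec : Vᴴ * A * V = diagonal l := by
    have h : A = V * diagonal l * Vᴴ := by
      simpa [Unitary.conjStarAlgAut_apply, star_eq_conjTranspose, Function.comp_def]
        using hA.spectral_theorem
    rw [h, show Vᴴ * (V * diagonal l * Vᴴ) * V = (Vᴴ * V) * diagonal l * (Vᴴ * V) by
      simp only [mul_assoc], hVV, one_mul, mul_one]
  have hdetA : ∏ j, l j = 1 := by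
    have h : A.det = 1 := by
      rw [hAdef, det_mul, det_conjTranspose]
      simp
    simpa [h] using hA.det_eq_prod_eigenvalues.symm
  set s : ι → ℝ := fun j => Real.log (l j) / 2 with hs
  have hsum : ∑ k, s k = 0 := by
    rw [hs, ← Finset.sum_div, ← Real.log_prod (fun j _ => (hlpos j).ne'), hdetA]
    simp
  have hexp (j : ι) : Real.exp (s j) * Real.exp (s j) = l j := by
    rw [← Real.exp_add, hs, add_halves, Real.exp_log (hlpos j)]
  set D : Matrix ι ι ℝ := diagonal fun j => Real.exp (s j) with hD
  set D' : Matrix ι ι ℝ := diagonal fun j => Real.exp (-s j) with hD'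
  set e : ℝ := V.det with he
  have hee : e * e = 1 := by
    have h := congrArg det hVV
    rwa [det_mul, det_conjTranspose, star_trivial, det_one] at h
  set S : Matrix ι ι ℝ := diagonal (Function.update 1 i₀ e) with hS
  have hSS : S * S = 1 := by
    rw [hS, diagonal_mul_diagonal, ← diagonal_one]
    congr 1
    funext j
    by_cases h : j = i₀
    · subst h; simp [hee]
    · simp [h]
  have hSdet : S.det = e := by
    rw [hS, det_diagonal, Finset.prod_update_of_mem (Finset.mem_univ _)]
    simp
  have hSstar : Sᴴ = S := by simp [hS]
  have hD'star : D'ᴴ = D' := by simp [hD']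
  have hSD : S * D = D * S := by
    rw [hS, hD, diagonal_mul_diagonal, diagonal_mul_diagonal]
    simp only [mul_comm]
  have hD'D : D' * D = 1 := by
    rw [hD, hD', diagonal_mul_diagonal, ← diagonal_one]
    congr 1
    funext j
    rw [← Real.exp_add]
    simp
  have hD'l : D' * diagonal l * D' = 1 := by
    rw [hD', diagonal_mul_diagonal, diagonal_mul_diagonal, ← diagonal_one]
    congr 1
    funext j
    rw [← hexp, show ∀ a b : ℝ, a * (b * b) * a = (a * b) * (a * b) by intros; ring,
      ← Real.exp_add]
    simp
  have hD'det : D'.det = 1 := by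
    rw [hD', det_diagonal, ← Real.exp_sum, Finset.sum_neg_distrib, hsum]
    simp
  have hu : (g * V * D' * S : Matrix ι ι ℝ)ᴴ * (g * V * D' * S) = 1 := by
    simp only [conjTranspose_mul, hSstar, hD'star]
    calc S * (D' * (Vᴴ * (g : Matrix ι ι ℝ)ᴴ)) * (g * V * D' * S)
        = S * (D' * (Vᴴ * A * V) * D') * S := by simp only [hAdef, mul_assoc]
      _ = 1 := by rw [hspec, hD'l, mul_one, hSS]
  have hv : (S * Vᴴ) * (S * Vᴴ)ᴴ = 1 := by
    rw [conjTranspose_mul, conjTranspose_conjTranspose, hSstar,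
      show S * Vᴴ * (V * S) = S * (Vᴴ * V) * S by simp only [mul_assoc], hVV, mul_one, hSS]
  refine ⟨⟨g * V * D' * S, by simp [det_mul, hD'det, hSdet, ← he, hee]⟩,
    ⟨S * Vᴴ, by simp [det_mul, hSdet, ← he, hee]⟩, s,
    mem_unitaryGroup_iff'.2 hu, mem_unitaryGroup_iff.2 hv, hsum, ?_⟩
  apply specialLinearGroup_eq_of_coe_eq
  change (g : Matrix ι ι ℝ) = g * V * D' * S * (diagExp i₀ s : Matrix ι ι ℝ) * (S * Vᴴ)
  rw [coe_diagExp_of_sum_eq_zero i₀ hsum, ← hD]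
  calc (g : Matrix ι ι ℝ) = g * V * (D' * D) * (S * S) * Vᴴ := by
        rw [hD'D, hSS, mul_one, mul_one, mul_assoc, hVV', mul_one]
    _ = g * V * D' * (D * S) * (S * Vᴴ) := by simp only [mul_assoc]
    _ = _ := by rw [← hSD]; simp only [mul_assoc]

lemma abs_le_of_norm_le_exp (i₀ : ι) {g u v : SpecialLinearGroup ι ℝ} {s : ι → ℝ} {L : ℝ}
    (hu : (u : Matrix ι ι ℝ) ∈ unitaryGroup ι ℝ) (hv : (v : Matrix ι ι ℝ) ∈ unitaryGroup ι ℝ)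
    (hs : ∑ k, s k = 0) (hg : g = u * diagExp i₀ s * v)
    (hL : ‖(g : Matrix ι ι ℝ)‖ ≤ Real.exp L)
    (hL' : ‖((g⁻¹ : SpecialLinearGroup ι ℝ) : Matrix ι ι ℝ)‖ ≤ Real.exp L) (j : ι) :
    |s j| ≤ L := by
  have hinv {w : SpecialLinearGroup ι ℝ} (hw : (w : Matrix ι ι ℝ) ∈ unitaryGroup ι ℝ) :
      ((w⁻¹ : SpecialLinearGroup ι ℝ) : Matrix ι ι ℝ) ∈ unitaryGroup ι ℝ := by
    have h : ((w⁻¹ : SpecialLinearGroup ι ℝ) : Matrix ι ι ℝ) = star (w : Matrix ι ι ℝ) := by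
      have h1 : ((w⁻¹ : SpecialLinearGroup ι ℝ) : Matrix ι ι ℝ) * w = 1 := by
        rw [← Matrix.SpecialLinearGroup.coe_mul, inv_mul_cancel, Matrix.SpecialLinearGroup.coe_one]
      exact left_inv_eq_right_inv h1 (mem_unitaryGroup_iff.1 hw)
    rw [h]
    exact Unitary.star_mem hw
  have hbound {p w q : SpecialLinearGroup ι ℝ} (hp : (p : Matrix ι ι ℝ) ∈ unitaryGroup ι ℝ)
      (hq : (q : Matrix ι ι ℝ) ∈ unitaryGroup ι ℝ) {t : ι → ℝ} (ht : ∑ k, t k = 0)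
      (hw : diagExp i₀ t = p * w * q) (hwL : ‖(w : Matrix ι ι ℝ)‖ ≤ Real.exp L) : t j ≤ L := by
    have h1 : ‖(diagExp i₀ t : Matrix ι ι ℝ)‖ ≤ Real.exp L := by
      rw [hw, Matrix.SpecialLinearGroup.coe_mul, Matrix.SpecialLinearGroup.coe_mul,
        CStarRing.norm_mul_mem_unitary _ hq, CStarRing.norm_mem_unitary_mul _ hp]
      exact hwL
    rw [coe_diagExp_of_sum_eq_zero i₀ ht, l2_opNorm_diagonal] at h1
    have h2 := (norm_le_pi_norm (fun j => Real.exp (t j)) j).trans h1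
    rwa [Real.norm_eq_abs, Real.abs_exp, Real.exp_le_exp] at h2
  refine abs_le'.2 ⟨hbound (hinv hu) (hinv hv) hs ?_ hL, ?_⟩
  · rw [hg]; group
  · exact hbound (t := -s) hv hu (by simp [hs]) (by rw [diagExp_neg, hg]; group) hL'

/-- A cocycle on `SL(n, ℝ)` grows sublinearly in the logarithm of the norm. -/
lemma exists_norm_cocycle_le_of_norm_le_exp (i₀ : ι) {H : Type*} [NormedAddCommGroup H]
    [InnerProductSpace ℂ H] [CompleteSpace H] {π : SpecialLinearGroup ι ℝ →* (H ≃ₗᵢ[ℂ] H)}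
    (hπ : ∀ v : H, Continuous fun g => π g v) {b : SpecialLinearGroup ι ℝ → H}
    (hbcont : Continuous b) (hb : ∀ g h, b (g * h) = b g + π g (b h)) {ε : ℝ} (hε : 0 < ε) :
    ∃ C, ∀ (g : SpecialLinearGroup ι ℝ) (L : ℝ), ‖(g : Matrix ι ι ℝ)‖ ≤ Real.exp L →
      ‖((g⁻¹ : SpecialLinearGroup ι ℝ) : Matrix ι ι ℝ)‖ ≤ Real.exp L → ‖b g‖ ≤ ε * L + C := by
  obtain ⟨K, hK⟩ := isCompact_setOf_mem_unitaryGroup.bddAbove_image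
    (hbcont.norm.continuousOn
      (s := {g : SpecialLinearGroup ι ℝ | (g : Matrix ι ι ℝ) ∈ unitaryGroup ι ℝ}))
  have hcard : (0 : ℝ) < Fintype.card ι := by
    exact_mod_cast Fintype.card_pos_iff.2 ⟨i₀⟩
  have hline (j : ι) : ∃ C, ∀ x : ℝ,
      ‖b (diagExp i₀ (Pi.single j x))‖ ≤ ε / Fintype.card ι * |x| + C := by
    have hε' := div_pos hε hcard
    by_cases hj : i₀ = j
    · subst hj
      refine ⟨0, fun x => ?_⟩
      rw [diagExp_single_self, cocycle_one hb, norm_zero]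
      positivity
    · refine exists_le_mul_abs_add_of_subadditive ?_ (fun x y => ?_) (fun x => ?_) ?_ hε'
      · exact (hbcont.comp ((continuous_diagExp i₀).comp (continuous_single j))).norm
      · rw [Pi.single_add, diagExp_add]
        exact norm_cocycle_mul_le hb _ _
      · rw [Pi.single_neg, diagExp_neg, norm_cocycle_inv hb]
      · have h := (tendsto_inv_smul_cocycle_pow hπ hbcont hb
          (diagExp_single_mem_closure i₀ hj rfl)).norm
        rw [norm_zero] at h
        refine h.congr fun n => ?_
        rw [norm_smul, ← diagExp_nsmul, ← Pi.single_smul]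
        simp
  choose C hC using hline
  refine ⟨2 * K + ∑ j, C j, fun g L hg hg' => ?_⟩
  obtain ⟨u, v, s, hu, hv, hs, rfl⟩ := exists_eq_unitary_mul_diagExp_mul_unitary i₀ g
  have hsL := abs_le_of_norm_le_exp i₀ hu hv hs rfl hg hg'
  have hsum : ‖b (diagExp i₀ s)‖ ≤ ∑ j, ‖b (diagExp i₀ (Pi.single j (s j)))‖ := by
    conv_lhs => rw [← Finset.univ_sum_single s]
    refine Finset.le_sum_of_subadditive (fun t => ‖b (diagExp i₀ t)‖) ?_ (fun x y => ?_) _ _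
    · rw [diagExp_zero, cocycle_one hb, norm_zero]
    · rw [diagExp_add]
      exact norm_cocycle_mul_le hb _ _
  have hterm : ∑ j, ‖b (diagExp i₀ (Pi.single j (s j)))‖ ≤
      ∑ j, (ε / Fintype.card ι * L + C j) := by
    refine Finset.sum_le_sum fun j _ => (hC j (s j)).trans ?_
    have := hsL j
    gcongr
  rw [Finset.sum_add_distrib, Finset.sum_const, Finset.card_univ, nsmul_eq_mul,
    ← mul_assoc, mul_div_cancel₀ _ hcard.ne'] at hterm
  have h1 := norm_cocycle_mul_le hb (u * diagExp i₀ s) v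
  have h2 := norm_cocycle_mul_le hb u (diagExp i₀ s)
  have h3 := hK (Set.mem_image_of_mem _ hu)
  have h4 := hK (Set.mem_image_of_mem _ hv)
  linarith

end SpecialLinear

section ProductWordLength

open scoped Matrix.Norms.L2Operator

variable {κ : Type*} {n : κ → ℕ}

lemma exists_norm_le_exp_of_mem_pow [Fintype κ]
    {Q : Set (∀ i, Matrix.SpecialLinearGroup (Fin (n i)) ℝ)} (hQ : IsCompact Q) :
    ∃ L : ℝ, 0 ≤ L ∧ ∀ (m : ℕ), ∀ g ∈ Q ^ m, ∀ i,
      ‖(g i : Matrix (Fin (n i)) (Fin (n i)) ℝ)‖ ≤ Real.exp (m * L) := by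
  have hcont (i : κ) : Continuous fun g : ∀ i, Matrix.SpecialLinearGroup (Fin (n i)) ℝ =>
      ‖(g i : Matrix (Fin (n i)) (Fin (n i)) ℝ)‖ :=
    (continuous_induced_dom.comp (continuous_apply i)).norm
  choose K hK using fun i => hQ.bddAbove_image (hcont i).continuousOn
  have hL : 0 ≤ ∑ i, |K i| := Finset.sum_nonneg fun i _ => abs_nonneg _
  refine ⟨∑ i, |K i|, hL, fun m => ?_⟩
  induction m with
  | zero =>
    intro g hg i
    rw [pow_zero, Set.mem_one] at hg
    rw [hg, Pi.one_apply, Matrix.SpecialLinearGroup.coe_one, Nat.cast_zero, zero_mul,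
      Real.exp_zero, ← Matrix.diagonal_one, Matrix.l2_opNorm_diagonal]
    exact (pi_norm_const_le _).trans norm_one.le
  | succ m ih =>
    intro g hg i
    rw [pow_succ] at hg
    obtain ⟨p, hp, q, hq, rfl⟩ := hg
    have hqi : ‖(q i : Matrix (Fin (n i)) (Fin (n i)) ℝ)‖ ≤ Real.exp (∑ i, |K i|) := by
      have h1 := hK i (Set.mem_image_of_mem _ hq)
      have h2 := Finset.single_le_sum (f := fun i => |K i|) (fun i _ => abs_nonneg _)
        (Finset.mem_univ i)
      have h3 := Real.add_one_le_exp (∑ i, |K i|)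
      have h4 := le_abs_self (K i)
      exact h1.trans (by linarith)
    change ‖(((p i * q i : Matrix.SpecialLinearGroup (Fin (n i)) ℝ)) :
      Matrix (Fin (n i)) (Fin (n i)) ℝ)‖ ≤ _
    rw [Matrix.SpecialLinearGroup.coe_mul, Nat.cast_succ, add_mul, one_mul,
      Real.exp_add]
    refine (Matrix.l2_opNorm_mul _ _).trans ?_
    have := ih p hp i
    gcongr

lemma norm_cocycle_le_sum_mulSingle [Fintype κ] [DecidableEq κ] {G : κ → Type*}
    [∀ i, Group (G i)] {H : Type*} [NormedAddCommGroup H] [InnerProductSpace ℂ H]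
    {π : (∀ i, G i) →* (H ≃ₗᵢ[ℂ] H)}
    {b : (∀ i, G i) → H} (hb : ∀ g h, b (g * h) = b g + π g (b h)) (g : ∀ i, G i) :
    ‖b g‖ ≤ ∑ i, ‖b (Pi.mulSingle i (g i))‖ := by
  have key (s : Finset κ) :
      ‖b fun i => if i ∈ s then g i else 1‖ ≤ ∑ i ∈ s, ‖b (Pi.mulSingle i (g i))‖ := by
    induction s using Finset.induction_on with
    | empty =>
      simpa [Pi.one_def] using cocycle_one hb
    | insert j s hj ih =>
      have hmul : (fun i => if i ∈ insert j s then g i else 1) =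
          Pi.mulSingle j (g j) * fun i => if i ∈ s then g i else 1 := by
        funext i
        by_cases h : i = j
        · subst h; simp [hj]
        · simp [h]
      rw [hmul, Finset.sum_insert hj]
      exact (norm_cocycle_mul_le hb _ _).trans (by gcongr)
  simpa using key Finset.univ

/-- Uniform version of `exists_norm_cocycle_le_of_norm_le_exp` over the factors of a product. -/
lemma exists_norm_cocycle_mulSingle_le [DecidableEq κ] (hn : ∀ i, 0 < n i) {H : Type*}
    [NormedAddCommGroup H] [InnerProductSpace ℂ H] [CompleteSpace H]
    {π : (∀ i, Matrix.SpecialLinearGroup (Fin (n i)) ℝ) →* (H ≃ₗᵢ[ℂ] H)}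
    (hπ : ∀ v : H, Continuous fun g => π g v)
    {b : (∀ i, Matrix.SpecialLinearGroup (Fin (n i)) ℝ) → H} (hbcont : Continuous b)
    (hb : ∀ g h, b (g * h) = b g + π g (b h)) {ε : ℝ} (hε : 0 < ε) (i : κ) :
    ∃ C, ∀ (x : Matrix.SpecialLinearGroup (Fin (n i)) ℝ) (L : ℝ),
      ‖(x : Matrix (Fin (n i)) (Fin (n i)) ℝ)‖ ≤ Real.exp L →
      ‖((x⁻¹ : Matrix.SpecialLinearGroup (Fin (n i)) ℝ) :
        Matrix (Fin (n i)) (Fin (n i)) ℝ)‖ ≤ Real.exp L →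
      ‖b (Pi.mulSingle i x)‖ ≤ ε * L + C := by
  have hcont : Continuous fun x : Matrix.SpecialLinearGroup (Fin (n i)) ℝ =>
      (Pi.mulSingle i x : ∀ i, Matrix.SpecialLinearGroup (Fin (n i)) ℝ) :=
    continuous_mulSingle (A := fun i => Matrix.SpecialLinearGroup (Fin (n i)) ℝ) i
  exact exists_norm_cocycle_le_of_norm_le_exp ⟨0, hn i⟩
    (π := π.comp (MonoidHom.mulSingle (fun i => Matrix.SpecialLinearGroup (Fin (n i)) ℝ) i))
    (b := fun x => b (Pi.mulSingle i x)) (fun v => (hπ v).comp hcont) (hbcont.comp hcont)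
    (fun x y => by rw [Pi.mulSingle_mul, hb]; rfl) hε

end ProductWordLength

/-- For `G = SL(n₁, ℝ) × ⋯ × SL(n_k, ℝ)` with `k ≥ 1` and all `nᵢ ≥ 2`, every continuous
1-cocycle over every unitary representation of `G` has sublinear growth with respect to the
word length of any compact symmetric generating set `Q ∋ 1`. -/
theorem sublinearGrowth_cocycles_of_SL_product
    {k : ℕ} (hk : 1 ≤ k) (n : Fin k → ℕ) (hn : ∀ i, 2 ≤ n i)
    (Q : Set (∀ i : Fin k, Matrix.SpecialLinearGroup (Fin (n i)) ℝ))
    (hQcomp : IsCompact Q) (hQsymm : Q⁻¹ = Q)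
    (hQone : (1 : ∀ i : Fin k, Matrix.SpecialLinearGroup (Fin (n i)) ℝ) ∈ Q)
    (hQgen : Subgroup.closure Q = ⊤)
    {H : Type*} [NormedAddCommGroup H] [InnerProductSpace ℂ H] [CompleteSpace H]
    (π : (∀ i : Fin k, Matrix.SpecialLinearGroup (Fin (n i)) ℝ) →* (H ≃ₗᵢ[ℂ] H))
    (hπ : ∀ v : H, Continuous fun g : ∀ i : Fin k, Matrix.SpecialLinearGroup (Fin (n i)) ℝ =>
      π g v)
    (b : (∀ i : Fin k, Matrix.SpecialLinearGroup (Fin (n i)) ℝ) → H)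
    (hbcont : Continuous b)
    (hbcoc : ∀ g h : ∀ i : Fin k, Matrix.SpecialLinearGroup (Fin (n i)) ℝ,
      b (g * h) = b g + π g (b h)) :
    HasSublinearGrowth Q b := by
  intro ε hε
  obtain ⟨L, hL, hQL⟩ := exists_norm_le_exp_of_mem_pow hQcomp
  have hk' : (0 : ℝ) < k := by exact_mod_cast hk
  set δ : ℝ := ε / (2 * k * (L + 1)) with hδ
  have hδpos : 0 < δ := by positivity
  choose C hC using exists_norm_cocycle_mulSingle_le (fun i => two_pos.trans_le (hn i)) hπ hbcont
    hbcoc hδpos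
  obtain ⟨N, hN⟩ := exists_nat_gt (2 * (∑ i, C i) / ε)
  refine ⟨N, fun g hg => ?_⟩
  set m := wordLength Q g with hm
  have hgm : g ∈ Q ^ m := Nat.sInf_mem (Nat.nonempty_of_pos_sInf (Nat.zero_lt_of_lt hg))
  have hgm' : g⁻¹ ∈ Q ^ m := by
    rw [← hQsymm, inv_pow]
    exact Set.inv_mem_inv.2 hgm
  have hsum : ‖b g‖ ≤ ∑ i, (δ * (m * L) + C i) :=
    (norm_cocycle_le_sum_mulSingle hbcoc g).trans
      (Finset.sum_le_sum fun i _ => hC i _ _ (hQL m g hgm i) (hQL m _ hgm' i))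
  rw [Finset.sum_add_distrib, Finset.sum_const, Finset.card_univ, Fintype.card_fin,
    nsmul_eq_mul] at hsum
  have hmain : k * (δ * (m * L)) ≤ ε / 2 * m := by
    have h : k * (δ * (m * L)) = ε / 2 * m * (L / (L + 1)) := by
      rw [hδ]; field_simp
    rw [h]
    exact mul_le_of_le_one_right (by positivity) ((div_le_one (by linarith)).2 (by linarith))
  have hNm : (N : ℝ) < m := by exact_mod_cast hg
  have hCm : 2 * (∑ i, C i) < ε * m := by
    have := (div_lt_iff₀ hε).1 (hN.trans hNm)
    linarith
  linarith
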